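/- Let T_i : ℝⁿ → ℝⁿ be continuous for all i ∈ I and assume: (a) inv𝒫 ∩ P₂(ℝⁿ) ≠ ∅; (b) the update function Φ is almost α-firmly nonexpansive in expectation with constant α ∈ (0,1) and violation ε ∈ [0,1): E[‖Φ(x,ξ)−Φ(y,ξ)‖²] ≤ (1+ε)‖x−y‖² − ((1−α)/α) E[‖(x−Φ(x,ξ))−(y−Φ(y,ξ))‖²] for all x,y; (c) the Markov transport discrepancy Ψ takes the value 0 only at invariant measures and is metrically subregular (in the W₂ metric) for 0 on P₂(ℝⁿ): inf_{π'∈Ψ⁻¹(0)∩P₂(ℝⁿ)} W₂(μ, π') ≤ ρ(Ψ(μ)) for all μ ∈ P₂(ℝⁿ), where the gauge ρ is related to τ := (1−α)/α via θ(t) := ((1+ε)t² − τ·(ρ⁻¹(t))²)^{1/2} and θ satisfies θ(0) = 0, 0 < θ(t) < t for all t > 0, and Σ_{j=1}^{∞} θ^{(j)}(t) < ∞ for all t ≥ 0 (θ^{(j)} being the j-fold iterate of θ). Then for every μ₀ ∈ P₂(ℝⁿ) the distributions μ_k := μ₀𝒫ᵏ converge in the W₂ metric to some invariant measure π^{μ₀}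 ∈ inv𝒫 ∩ P₂(ℝⁿ), and the convergence rate satisfies d_{W₂}(μ_{k+1}, inv𝒫) ≤ θ(d_{W₂}(μ_k, inv𝒫)) for all k ∈ ℕ, where d_{W₂}(μ, inv𝒫) := inf_{π'∈inv𝒫} W₂(μ, π'). -/

import Mathlib

open MeasureTheory Filter Topology

noncomputable section

/-- One application of the dual Markov operator of the RFI, with `μξ` the law of `ξ`. -/
def markovStep {G I : Type*} [MeasurableSpace G] [MeasurableSpace I]
    (μξ : MeasureTheory.Measure I) (T : I → G → G) (μ : MeasureTheory.Measure G) :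
    MeasureTheory.Measure G :=
  μ.bind fun x => μξ.map fun i => T i x

/-- Squared distance `‖x - y‖²` as an extended nonnegative real. -/
def q2 {H : Type*} [NormedAddCommGroup H] (x y : H) : ENNReal :=
  (‖x - y‖₊ : ENNReal) ^ 2

/-- `γ` is a coupling of `(μ, ν)`: a measure on the product with marginals `μ` and `ν`. -/
def IsCoupling {H : Type*} [MeasurableSpace H]
    (γ : MeasureTheory.Measure (H × H)) (μ ν : MeasureTheory.Measure H) : Prop :=
  γ.map Prod.fst = μ ∧ γ.map Prod.snd = ν

/-- The squared Wasserstein-2 distance `W₂(μ,ν)²`. -/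
def W2sq {H : Type*} [MeasurableSpace H] [NormedAddCommGroup H]
    (μ ν : MeasureTheory.Measure H) : ENNReal :=
  ⨅ (γ : MeasureTheory.Measure (H × H)) (_ : IsCoupling γ μ ν), ∫⁻ p, q2 p.1 p.2 ∂γ

/-- An optimal coupling of `(μ, ν)`: a coupling attaining `W₂(μ,ν)²`. -/
def IsOptCoupling {H : Type*} [MeasurableSpace H] [NormedAddCommGroup H]
    (γ : MeasureTheory.Measure (H × H)) (μ ν : MeasureTheory.Measure H) : Prop :=
  IsCoupling γ μ ν ∧ ∫⁻ p, q2 p.1 p.2 ∂γ = W2sq μ ν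

/-- Membership in `P₂(H)`: probability measures with finite second moment. -/
def MemP2 {H : Type*} [MeasurableSpace H] [NormedAddCommGroup H]
    (μ : MeasureTheory.Measure H) : Prop :=
  MeasureTheory.IsProbabilityMeasure μ ∧ ∃ x : H, ∫⁻ y, q2 x y ∂μ < ⊤


/-- The set of invariant probability measures of the RFI Markov operator. -/
def invSet {H I : Type*} [MeasurableSpace H] [MeasurableSpace I]
    (μξ : MeasureTheory.Measure I) (T : I → H → H) : Set (MeasureTheory.Measure H) :=
  {π | MeasureTheory.IsProbabilityMeasure π ∧ markovStep μξ T π = π}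

/-- The squared Markov transport discrepancy, `+∞` when `inv 𝒫` is empty or no optimal
coupling exists. -/
def PsiSq {H I : Type*} [MeasurableSpace H] [NormedAddCommGroup H] [MeasurableSpace I]
    (μξ : MeasureTheory.Measure I) (T : I → H → H) (μ : MeasureTheory.Measure H) :
    ENNReal :=
  ⨅ (π' : MeasureTheory.Measure H) (_ : π' ∈ invSet μξ T)
    (γ : MeasureTheory.Measure (H × H)) (_ : IsOptCoupling γ μ π'),
      ∫⁻ p, (∫⁻ i, q2 (p.1 - T i p.1) (p.2 - T i p.2) ∂μξ) ∂γ

/-- The (real-valued) Wasserstein-2 distance. -/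
def W2r {H : Type*} [MeasurableSpace H] [NormedAddCommGroup H]
    (μ ν : MeasureTheory.Measure H) : ℝ :=
  Real.sqrt (W2sq μ ν).toReal

/-- The (real-valued) Markov transport discrepancy `Ψ`. -/
def Psi {H I : Type*} [MeasurableSpace H] [NormedAddCommGroup H] [MeasurableSpace I]
    (μξ : MeasureTheory.Measure I) (T : I → H → H) (μ : MeasureTheory.Measure H) : ℝ :=
  Real.sqrt (PsiSq μξ T μ).toReal

/-- The `W₂`-distance of `μ` to the set of invariant probability measures,
`d_{W₂}(μ, inv 𝒫) = inf_{π' ∈ inv 𝒫} W₂(μ, π')`. -/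
def dW2inv {H I : Type*} [MeasurableSpace H] [NormedAddCommGroup H] [MeasurableSpace I]
    (μξ : MeasureTheory.Measure I) (T : I → H → H) (μ : MeasureTheory.Measure H) : ℝ :=
  Real.sqrt ((⨅ (π' : MeasureTheory.Measure H) (_ : π' ∈ invSet μξ T), W2sq μ π').toReal)

section SubOrbit

variable {θ : ℝ → ℝ}

lemma iterate_nonneg_of_lt_self (hθ0 : θ 0 = 0) (hθlt : ∀ t : ℝ, 0 < t → 0 < θ t ∧ θ t < t)
    {t : ℝ} (ht : 0 ≤ t) (j : ℕ) : 0 ≤ θ^[j] t := by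
  induction j with
  | zero => simpa using ht
  | succ j ih =>
    rw [Function.iterate_succ_apply']
    rcases ih.eq_or_lt with h | h
    · rw [← h, hθ0]
    · exact (hθlt _ h).1.le

lemma iterate_antitone_of_lt_self (hθ0 : θ 0 = 0) (hθlt : ∀ t : ℝ, 0 < t → 0 < θ t ∧ θ t < t)
    {t : ℝ} (ht : 0 ≤ t) : Antitone fun j : ℕ => θ^[j] t := by
  refine antitone_nat_of_succ_le fun j => ?_
  rw [Function.iterate_succ_apply']
  rcases (iterate_nonneg_of_lt_self hθ0 hθlt ht j).eq_or_lt with h | h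
  · rw [← h, hθ0]
  · exact (hθlt _ h).2.le

lemma continuousOn_iterate_of_lt_self (hc : ContinuousOn θ (Set.Ici 0)) (hθ0 : θ 0 = 0)
    (hθlt : ∀ t : ℝ, 0 < t → 0 < θ t ∧ θ t < t) (j : ℕ) :
    ContinuousOn (θ^[j]) (Set.Ici 0) :=
  hc.iterate (fun t ht => by
    simpa using iterate_nonneg_of_lt_self hθ0 hθlt (Set.mem_Ici.1 ht) 1) j

lemma exists_iterate_eq (hc : ContinuousOn θ (Set.Ici 0)) (hθ0 : θ 0 = 0)
    (hθlt : ∀ t : ℝ, 0 < t → 0 < θ t ∧ θ t < t)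
    (hlim : ∀ t : ℝ, 0 ≤ t → Tendsto (fun j : ℕ => θ^[j] t) atTop (𝓝 0))
    {a y : ℝ} (ha : 0 < a) (hy : 0 < y) (hya : y ≤ a) :
    ∃ x ∈ Set.Icc (θ a) a, ∃ j, θ^[j] x = y := by
  have hex : ∃ j, θ^[j] a < y := ((hlim a ha.le).eventually_lt_const hy).exists
  classical
  obtain ⟨k, hk⟩ : ∃ k, Nat.find hex = k + 1 := by
    refine Nat.exists_eq_succ_of_ne_zero fun h => ?_
    have := Nat.find_spec hex
    rw [h] at this
    simp only [Function.iterate_zero, id_eq] at this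
    linarith
  have h1 : θ^[k + 1] a < y := hk ▸ Nat.find_spec hex
  have h2 : y ≤ θ^[k] a := not_lt.1 (Nat.find_min hex (by omega))
  rw [Function.iterate_succ_apply] at h1
  have hcont : ContinuousOn (θ^[k]) (Set.Icc (θ a) a) :=
    (continuousOn_iterate_of_lt_self hc hθ0 hθlt k).mono
      fun t ht => (hθlt a ha).1.le.trans ht.1
  obtain ⟨x, hx, hxy⟩ := intermediate_value_Icc (hθlt a ha).2.le hcont ⟨h1.le, h2⟩
  exact ⟨x, hx, k, hxy⟩

lemma exists_orbit_hits_finitely_many (hc : ContinuousOn θ (Set.Ici 0)) (hθ0 : θ 0 = 0)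
    (hθlt : ∀ t : ℝ, 0 < t → 0 < θ t ∧ θ t < t)
    (hlim : ∀ t : ℝ, 0 ≤ t → Tendsto (fun j : ℕ => θ^[j] t) atTop (𝓝 0)) (K : ℕ) :
    ∀ d : ℕ → ℝ, (∀ k, 0 < d k) → (∀ k, d (k + 1) ≤ θ (d k)) →
      ∃ y ∈ Set.Icc (θ (d 0)) (d 0), ∀ k ≤ K, ∃ j, θ^[j] y ∈ Set.Icc (θ (d k)) (d k) := by
  induction K with
  | zero =>
    intro d hpos _
    have h := (hθlt _ (hpos 0)).2.le
    refine ⟨d 0, ⟨h, le_rfl⟩, fun k hk => ⟨0, ?_⟩⟩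
    obtain rfl : k = 0 := by omega
    exact ⟨h, le_rfl⟩
  | succ K ih =>
    intro d hpos hd
    obtain ⟨y, hy, hhit⟩ := ih (fun k => d (k + 1)) (fun k => hpos _) (fun k => hd _)
    obtain ⟨x, hx, i, rfl⟩ := exists_iterate_eq hc hθ0 hθlt hlim (hpos 0)
      ((hθlt _ (hpos 1)).1.trans_le hy.1) ((hy.2.trans (hd 0)).trans (hθlt _ (hpos 0)).2.le)
    refine ⟨x, hx, fun k hk => ?_⟩
    rcases k with _ | k
    · exact ⟨0, hx⟩
    · obtain ⟨j, hj⟩ := hhit k (by omega)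
      exact ⟨j + i, by rwa [Function.iterate_add_apply]⟩

lemma exists_orbit_hits_all (hc : ContinuousOn θ (Set.Ici 0)) (hθ0 : θ 0 = 0)
    (hθlt : ∀ t : ℝ, 0 < t → 0 < θ t ∧ θ t < t)
    (hlim : ∀ t : ℝ, 0 ≤ t → Tendsto (fun j : ℕ => θ^[j] t) atTop (𝓝 0))
    {d : ℕ → ℝ} (hpos : ∀ k, 0 < d k) (hd : ∀ k, d (k + 1) ≤ θ (d k)) :
    ∃ y, 0 ≤ y ∧ ∀ k, ∃ j, θ^[j] y ∈ Set.Icc (θ (d k)) (d k) := by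
  set J := Set.Icc (θ (d 0)) (d 0)
  have hJ : J ⊆ Set.Ici 0 := fun t ht => (hθlt _ (hpos 0)).1.le.trans ht.1
  have hcJ : ∀ j, ContinuousOn (θ^[j]) J := fun j =>
    (continuousOn_iterate_of_lt_self hc hθ0 hθlt j).mono hJ
  have hunif := Antitone.tendstoUniformlyOn_of_forall_tendsto (F := fun j => θ^[j])
    (f := fun _ => (0 : ℝ)) isCompact_Icc hcJ
    (fun t ht => iterate_antitone_of_lt_self hθ0 hθlt (hJ ht)) continuousOn_const
    (fun t ht => hlim t (hJ ht))
  have hclosed : ∀ k, IsClosed {y ∈ J | ∃ j, θ^[j] y ∈ Set.Icc (θ (d k)) (d k)} := by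
    intro k
    obtain ⟨N, hN⟩ := eventually_atTop.1
      (Metric.tendstoUniformlyOn_iff.1 hunif (θ (d k)) (hθlt _ (hpos k)).1)
    have heq : {y ∈ J | ∃ j, θ^[j] y ∈ Set.Icc (θ (d k)) (d k)} =
        ⋃ j ∈ Finset.range N, J ∩ θ^[j] ⁻¹' Set.Icc (θ (d k)) (d k) := by
      ext y
      simp only [Set.mem_iUnion, Set.mem_inter_iff, Set.mem_preimage, Finset.mem_range,
        exists_prop, Set.mem_ofPred_eq]
      constructor
      · rintro ⟨hy, j, hj⟩
        refine ⟨j, ?_, hy, hj⟩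
        by_contra! hjN
        have := hN j hjN y hy
        rw [Real.dist_eq, zero_sub, abs_neg] at this
        exact absurd ((le_abs_self _).trans_lt this) (not_lt.2 hj.1)
      · rintro ⟨j, -, hy, hj⟩
        exact ⟨hy, j, hj⟩
    rw [heq]
    exact (Finset.range N).finite_toSet.isClosed_biUnion fun j _ =>
      (hcJ j).preimage_isClosed_of_isClosed isClosed_Icc isClosed_Icc
  obtain ⟨y, hyJ, hy⟩ := (isCompact_Icc (a := θ (d 0)) (b := d 0)).inter_iInter_nonempty _ hclosed
    (fun u => by
      obtain ⟨y, hyJ, hy⟩ :=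
        exists_orbit_hits_finitely_many hc hθ0 hθlt hlim (u.sup id) d hpos hd
      refine ⟨y, hyJ, ?_⟩
      simp only [Set.mem_iInter]
      exact fun k hk => ⟨hyJ, hy k (Finset.le_sup (f := id) hk)⟩)
  exact ⟨y, hJ hyJ, fun k => (Set.mem_iInter.1 hy k).2⟩

/-- If all orbits of `θ` are summable, so is every nonnegative sequence decreasing at least as fast
as `θ` prescribes. No monotonicity of `θ` is needed: an orbit of `θ` visits every interval
`[θ (d k), d k]`. -/
lemma summable_of_succ_le (hc : ContinuousOn θ (Set.Ici 0)) (hθ0 : θ 0 = 0)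
    (hθlt : ∀ t : ℝ, 0 < t → 0 < θ t ∧ θ t < t)
    (hsum : ∀ t : ℝ, 0 ≤ t → Summable fun j : ℕ => θ^[j + 1] t)
    {d : ℕ → ℝ} (hnn : ∀ k, 0 ≤ d k) (hd : ∀ k, d (k + 1) ≤ θ (d k)) : Summable d := by
  have hsum' : ∀ t : ℝ, 0 ≤ t → Summable fun j : ℕ => θ^[j] t :=
    fun t ht => (summable_nat_add_iff 1).1 (hsum t ht)
  by_cases hpos : ∀ k, 0 < d k
  · obtain ⟨y, hy0, hy⟩ := exists_orbit_hits_all hc hθ0 hθlt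
      (fun t ht => (hsum' t ht).tendsto_atTop_zero) hpos hd
    choose j hj using hy
    have hanti : StrictAnti d := strictAnti_nat_of_succ_lt fun k =>
      (hd k).trans_lt (hθlt _ (hpos k)).2
    have hinj : Function.Injective fun k => j (2 * k) := by
      have key : ∀ k l, k < l → j (2 * k) ≠ j (2 * l) := by
        intro k l hkl h
        have h1 := (hj (2 * k)).1
        have h2 := (hj (2 * l)).2
        rw [h] at h1
        have h3 : d (2 * l) < d (2 * k + 1) := hanti (by omega)
        linarith [hd (2 * k)]
      intro k l h
      by_contra hne
      rcases lt_or_gt_of_ne hne with hlt | hlt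
      · exact key k l hlt h
      · exact key l k hlt h.symm
    have hodd : Summable fun k => d (2 * k + 1) :=
      Summable.of_nonneg_of_le (fun k => hnn _) (fun k => (hd _).trans (hj (2 * k)).1)
        ((hsum' y hy0).comp_injective hinj)
    have heven : Summable fun k => d (2 * k) :=
      (summable_nat_add_iff 1).1 (Summable.of_nonneg_of_le (fun k => hnn _)
        (fun k => (hanti (by omega : 2 * k + 1 < 2 * (k + 1))).le) hodd)
    exact (heven.hasSum.even_add_odd hodd.hasSum).summable
  · push Not at hpos
    obtain ⟨K, hK⟩ := hpos
    have hzero : ∀ m, d (m + K) = 0 := by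
      intro m
      induction m with
      | zero => rw [zero_add]; exact le_antisymm hK (hnn K)
      | succ m ih =>
        have h := hd (m + K)
        rw [ih, hθ0] at h
        rw [add_right_comm]
        exact le_antisymm h (hnn _)
    refine (summable_nat_add_iff K).1 ?_
    simp only [hzero]
    exact summable_zero

lemma image_Ici_of_gauge {ρ : ℝ → ℝ} (hρ0 : ρ 0 = 0) (hρcont : ContinuousOn ρ (Set.Ici (0 : ℝ)))
    (hρtop : Tendsto ρ atTop atTop) (hρnonneg : ∀ t : ℝ, 0 ≤ t → 0 ≤ ρ t) :
    ρ '' Set.Ici 0 = Set.Ici 0 := by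
  refine Set.Subset.antisymm ?_ fun s hs => ?_
  · rintro _ ⟨t, ht, rfl⟩
    exact hρnonneg t ht
  · obtain ⟨t, ht, ht0⟩ := ((hρtop.eventually_ge_atTop s).and (eventually_ge_atTop 0)).exists
    obtain ⟨x, hx, hxs⟩ := intermediate_value_Icc ht0
      (hρcont.mono Set.Icc_subset_Ici_self) ⟨hρ0.trans_le hs, ht⟩
    exact ⟨x, hx.1, hxs⟩

/-- A function determined by a gauge `ρ` through `θ (ρ t) ^ 2 = a ρ(t) ^ 2 - b t ^ 2` is
continuous. -/
lemma continuousOn_of_gauge {ρ : ℝ → ℝ} (hρ0 : ρ 0 = 0) (hρmono : StrictMonoOn ρ (Set.Ici (0 : ℝ)))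
    (hρcont : ContinuousOn ρ (Set.Ici (0 : ℝ))) (hρtop : Tendsto ρ atTop atTop)
    (hρnonneg : ∀ t : ℝ, 0 ≤ t → 0 ≤ ρ t) {a b : ℝ}
    (hρθ : ∀ t : ℝ, 0 ≤ t → (θ (ρ t)) ^ 2 = a * (ρ t) ^ 2 - b * t ^ 2)
    (hθnn : ∀ t, 0 ≤ t → 0 ≤ θ t) :
    ContinuousOn θ (Set.Ici 0) := by
  have himg := image_Ici_of_gauge hρ0 hρcont hρtop hρnonneg
  let e : Set.Ici (0 : ℝ) ≃o Set.Ici (0 : ℝ) :=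
    (hρmono.orderIso ρ _).trans (OrderIso.setCongr _ _ himg)
  have he : ∀ s : Set.Ici (0 : ℝ), ρ (e.symm s) = s := fun s => by
    exact congrArg Subtype.val (e.apply_symm_apply s)
  rw [continuousOn_iff_continuous_domRestrict]
  have heq : (Set.Ici 0).domRestrict θ =
      fun s : Set.Ici (0 : ℝ) => √(a * (s : ℝ) ^ 2 - b * (e.symm s : ℝ) ^ 2) := by
    ext s
    have h := hρθ (e.symm s) (e.symm s).2
    rw [he] at h
    rw [Set.domRestrict_apply, ← h, Real.sqrt_sq (hθnn _ s.2)]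
  rw [heq]
  have := e.symm.continuous
  fun_prop

end SubOrbit
section Coupling

variable {X : Type*} [MeasurableSpace X] {μ ν : Measure X} {γ : Measure (X × X)}

lemma IsCoupling.isProbabilityMeasure [IsProbabilityMeasure μ] (h : IsCoupling γ μ ν) :
    IsProbabilityMeasure γ := by
  refine ⟨?_⟩
  rw [← Set.preimage_univ (f := Prod.fst), ← Measure.map_apply measurable_fst MeasurableSet.univ,
    h.1, measure_univ]

lemma IsCoupling.swap (h : IsCoupling γ μ ν) : IsCoupling (γ.map Prod.swap) ν μ := by
  refine ⟨?_, ?_⟩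
  · rw [Measure.map_map measurable_fst measurable_swap]
    exact h.2
  · rw [Measure.map_map measurable_snd measurable_swap]
    exact h.1

lemma isCoupling_diag (μ : Measure X) : IsCoupling (μ.map fun x => (x, x)) μ μ := by
  have hm : Measurable fun x : X => (x, x) := measurable_id.prodMk measurable_id
  refine ⟨?_, ?_⟩
  · rw [Measure.map_map measurable_fst hm]
    exact Measure.map_id
  · rw [Measure.map_map measurable_snd hm]
    exact Measure.map_id

end Coupling

section Wasserstein

section Cost

variable {E : Type*} [NormedAddCommGroup E]

lemma q2_eq_ofReal (x y : E) : q2 x y = ENNReal.ofReal (‖x - y‖ ^ 2) := by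
  rw [q2, ENNReal.ofReal_pow (norm_nonneg _), ofReal_norm]
  rfl

lemma q2_comm (x y : E) : q2 x y = q2 y x := by
  simp only [q2_eq_ofReal, norm_sub_rev]

lemma q2_le_two_mul_add (x y z : E) : q2 x z ≤ 2 * q2 x y + 2 * q2 y z := by
  simp only [q2_eq_ofReal]
  rw [← ENNReal.ofReal_ofNat 2, ← ENNReal.ofReal_mul zero_le_two,
    ← ENNReal.ofReal_mul zero_le_two, ← ENNReal.ofReal_add (by positivity) (by positivity)]
  refine ENNReal.ofReal_le_ofReal ?_
  have h : ‖x - z‖ ≤ ‖x - y‖ + ‖y - z‖ := norm_sub_le_norm_sub_add_norm_sub x y z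
  have := norm_nonneg (x - z)
  nlinarith [sq_nonneg (‖x - y‖ - ‖y - z‖)]

end Cost

variable {E : Type*} [NormedAddCommGroup E] [MeasurableSpace E]

variable {μ ν σ : Measure E} {γ : Measure (E × E)}

lemma W2sq_le (h : IsCoupling γ μ ν) : W2sq μ ν ≤ ∫⁻ p, q2 p.1 p.2 ∂γ :=
  iInf₂_le γ h

variable [ProperSpace E] [BorelSpace E]

lemma measurable_q2 : Measurable fun p : E × E => q2 p.1 p.2 :=
  ((measurable_fst.sub measurable_snd).nnnorm.coe_nnreal_ennreal).pow_const 2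

lemma measurable_q2_right (a : E) : Measurable fun y : E => q2 a y :=
  measurable_q2.comp measurable_prodMk_left

lemma isOptCoupling_diag (μ : Measure E) : IsOptCoupling (μ.map fun x => (x, x)) μ μ := by
  refine ⟨isCoupling_diag μ, le_antisymm ?_ (W2sq_le (isCoupling_diag μ))⟩
  rw [lintegral_map measurable_q2 (by fun_prop)]
  simp [q2]

lemma W2sq_self (μ : Measure E) : W2sq μ μ = 0 := by
  rw [← (isOptCoupling_diag μ).2, lintegral_map measurable_q2 (by fun_prop)]
  simp [q2]

lemma W2sq_comm (μ ν : Measure E) : W2sq μ ν = W2sq ν μ := by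
  have key : ∀ μ ν : Measure E, W2sq μ ν ≤ W2sq ν μ := fun μ ν =>
    le_iInf₂ fun γ hγ => (W2sq_le hγ.swap).trans_eq <| by
      rw [lintegral_map measurable_q2 measurable_swap]
      simp only [Prod.fst_swap, Prod.snd_swap, q2_comm]
  exact le_antisymm (key μ ν) (key ν μ)

/-- Couplings of weakly convergent sequences subconverge to a coupling of the limits, and the
quadratic cost is lower semicontinuous along the way. -/
lemma exists_coupling_of_tendsto {μs νs : ℕ → ProbabilityMeasure E} {μ ν : ProbabilityMeasure E}
    (hμ : Tendsto μs atTop (𝓝 μ)) (hν : Tendsto νs atTop (𝓝 ν))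
    {γ : ℕ → Measure (E × E)} (hγ : ∀ l, IsCoupling (γ l) (μs l) (νs l))
    {c : ℕ → ENNReal} {c₀ : ENNReal} (hc : Tendsto c atTop (𝓝 c₀))
    (hle : ∀ l, ∫⁻ p, q2 p.1 p.2 ∂(γ l) ≤ c l) :
    ∃ γ₀, IsCoupling γ₀ (μ : Measure E) (ν : Measure E) ∧ ∫⁻ p, q2 p.1 p.2 ∂γ₀ ≤ c₀ := by
  have htight : ∀ {ms : ℕ → ProbabilityMeasure E} {m : ProbabilityMeasure E},
      Tendsto ms atTop (𝓝 m) →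
      IsTightMeasureSet {((m : ProbabilityMeasure E) : Measure E) | m ∈ Set.range ms} :=
    fun {ms m} hm => isTightMeasureSet_of_isCompact_closure
      (hm.isCompact_insert_range.closure_of_subset (Set.subset_insert _ _))
  let Γ : ℕ → ProbabilityMeasure (E × E) := fun l => ⟨γ l, (hγ l).isProbabilityMeasure⟩
  have hΓ : IsTightMeasureSet
      {((m : ProbabilityMeasure (E × E)) : Measure (E × E)) | m ∈ Set.range Γ} := by
    refine IsTightMeasureSet.prodMk ((htight hμ).subset ?_) ((htight hν).subset ?_)
    · rintro _ ⟨_, ⟨_, ⟨l, rfl⟩, rfl⟩, rfl⟩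
      exact ⟨μs l, ⟨l, rfl⟩, (hγ l).1.symm⟩
    · rintro _ ⟨_, ⟨_, ⟨l, rfl⟩, rfl⟩, rfl⟩
      exact ⟨νs l, ⟨l, rfl⟩, (hγ l).2.symm⟩
  obtain ⟨γ₀, -, φ, hφ, hlim⟩ := (isCompact_closure_of_isTightMeasureSet hΓ).tendsto_subseq
    (fun l => subset_closure (Set.mem_range_self l))
  have hmarg : ∀ {f : E × E → E} (hf : Continuous f) {ms : ℕ → ProbabilityMeasure E}
      {m : ProbabilityMeasure E}, Tendsto ms atTop (𝓝 m) →
      (∀ l, (γ l).map f = ms l) → (γ₀ : Measure (E × E)).map f = m := by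
    intro f hf ms m hm h
    have h1 := ProbabilityMeasure.tendsto_map_of_tendsto_of_continuous _ _ hlim hf
    have h2 : (fun l => ((Γ ∘ φ) l).map hf.measurable.aemeasurable) = ms ∘ φ := by
      ext1 l
      exact Subtype.ext (h (φ l))
    rw [h2] at h1
    have h3 := tendsto_nhds_unique h1 (hm.comp hφ.tendsto_atTop)
    exact congrArg (fun p : ProbabilityMeasure E => (p : Measure E)) h3
  refine ⟨γ₀, ⟨hmarg continuous_fst hμ fun l => (hγ l).1,
    hmarg continuous_snd hν fun l => (hγ l).2⟩, ?_⟩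
  have hlsc := lintegral_le_liminf_lintegral_of_forall_isOpen_measure_le_liminf_measure
    (f := fun p : E × E => ‖p.1 - p.2‖ ^ 2) (by fun_prop) (fun p => by positivity)
    (fun G hG => ProbabilityMeasure.le_liminf_measure_open_of_tendsto hlim hG)
  simp only [← q2_eq_ofReal] at hlsc
  exact (hlsc.trans (liminf_le_liminf (Eventually.of_forall fun l => hle (φ l)))).trans_eq
    (hc.comp hφ.tendsto_atTop).liminf_eq

lemma exists_isOptCoupling (μ ν : Measure E) [IsProbabilityMeasure μ] [IsProbabilityMeasure ν] :
    ∃ γ, IsOptCoupling γ μ ν := by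
  have hne : {c | ∃ γ, IsCoupling γ μ ν ∧ ∫⁻ p, q2 p.1 p.2 ∂γ = c}.Nonempty :=
    ⟨_, μ.prod ν, ⟨by simp, by simp⟩, rfl⟩
  let P : ProbabilityMeasure E := ⟨μ, inferInstance⟩
  let Q : ProbabilityMeasure E := ⟨ν, inferInstance⟩
  have hP : Tendsto (fun _ : ℕ => P) atTop (𝓝 P) := tendsto_const_nhds
  have hQ : Tendsto (fun _ : ℕ => Q) atTop (𝓝 Q) := tendsto_const_nhds
  obtain ⟨c, -, hc, hmem⟩ := exists_seq_tendsto_sInf hne (OrderBot.bddBelow _)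
  choose γ hγ hcost using hmem
  obtain ⟨γ₀, hγ₀, hle⟩ := exists_coupling_of_tendsto hP hQ hγ hc fun l => (hcost l).le
  refine ⟨γ₀, hγ₀, le_antisymm (hle.trans ?_) (W2sq_le hγ₀)⟩
  exact le_iInf₂ fun γ' hγ' => sInf_le ⟨γ', hγ', rfl⟩

lemma eq_of_W2sq_eq_zero [IsProbabilityMeasure μ] [IsProbabilityMeasure ν]
    (h : W2sq μ ν = 0) : μ = ν := by
  obtain ⟨γ, hγ, hopt⟩ := exists_isOptCoupling μ ν
  rw [h, lintegral_eq_zero_iff measurable_q2] at hopt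
  rw [← hγ.1, ← hγ.2]
  refine Measure.map_congr ?_
  filter_upwards [hopt] with p hp
  simpa [q2, sub_eq_zero] using hp

lemma lintegral_q2_le_of_isCoupling (h : IsCoupling γ μ ν) (a : E) :
    ∫⁻ y, q2 a y ∂ν ≤ 2 * ∫⁻ x, q2 a x ∂μ + 2 * ∫⁻ p, q2 p.1 p.2 ∂γ := by
  rw [← h.1, ← h.2, lintegral_map (measurable_q2_right a) measurable_fst,
    lintegral_map (measurable_q2_right a) measurable_snd,
    ← lintegral_const_mul 2 (f := fun p : E × E => q2 a p.1)
      ((measurable_q2_right a).comp measurable_fst),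
    ← lintegral_const_mul _ measurable_q2,
    ← lintegral_add_right _ (measurable_q2.const_mul 2)]
  exact lintegral_mono fun p => q2_le_two_mul_add a p.1 p.2

lemma lintegral_q2_le (a : E) [IsProbabilityMeasure μ] [IsProbabilityMeasure ν] :
    ∫⁻ y, q2 a y ∂ν ≤ 2 * ∫⁻ x, q2 a x ∂μ + 2 * W2sq μ ν := by
  obtain ⟨γ, hγ, hopt⟩ := exists_isOptCoupling μ ν
  rw [← hopt]
  exact lintegral_q2_le_of_isCoupling hγ a

lemma MemP2.of_W2sq_lt_top (hμ : MemP2 μ) (hν : IsProbabilityMeasure ν) (h : W2sq μ ν < ⊤) :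
    MemP2 ν := by
  have := hμ.1
  obtain ⟨-, a, ha⟩ := hμ
  exact ⟨hν, a, (lintegral_q2_le a).trans_lt (ENNReal.add_lt_top.2
    ⟨ENNReal.mul_lt_top (by simp) ha, ENNReal.mul_lt_top (by simp) h⟩)⟩

lemma MemP2.lintegral_q2_lt_top (hμ : MemP2 μ) (b : E) : ∫⁻ x, q2 b x ∂μ < ⊤ := by
  have := hμ.1
  obtain ⟨-, a, ha⟩ := hμ
  refine (lintegral_mono fun x => q2_le_two_mul_add b a x).trans_lt ?_
  rw [lintegral_add_left measurable_const, lintegral_const, measure_univ, mul_one,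
    lintegral_const_mul _ (measurable_q2_right a)]
  refine ENNReal.add_lt_top.2 ⟨?_, ENNReal.mul_lt_top (by simp) ha⟩
  simp [q2, ENNReal.mul_lt_top_iff]

lemma MemP2.W2sq_lt_top (hμ : MemP2 μ) (hν : MemP2 ν) : W2sq μ ν < ⊤ := by
  have := hμ.1
  have := hν.1
  refine (W2sq_le (γ := μ.prod ν) ⟨by simp, by simp⟩).trans_lt ?_
  rw [lintegral_prod _ measurable_q2.aemeasurable]
  have hle : ∀ x, ∫⁻ y, q2 x y ∂ν ≤ 2 * q2 0 x + 2 * ∫⁻ y, q2 0 y ∂ν := fun x => by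
    refine (lintegral_mono fun y => q2_le_two_mul_add x 0 y).trans_eq ?_
    rw [lintegral_add_left measurable_const, lintegral_const, measure_univ, mul_one, q2_comm x,
      lintegral_const_mul _ (measurable_q2_right 0)]
  refine (lintegral_mono hle).trans_lt ?_
  rw [lintegral_add_right _ measurable_const, lintegral_const, measure_univ, mul_one,
    lintegral_const_mul _ (measurable_q2_right 0)]
  exact ENNReal.add_lt_top.2 ⟨ENNReal.mul_lt_top (by simp) (hμ.lintegral_q2_lt_top 0),
    ENNReal.mul_lt_top (by simp) (hν.lintegral_q2_lt_top 0)⟩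

lemma isTightMeasureSet_of_lintegral_q2_le {S : Set (Measure E)} {a : E} {M : ENNReal}
    (hM : M ≠ ⊤) (h : ∀ μ ∈ S, ∫⁻ y, q2 a y ∂μ ≤ M) : IsTightMeasureSet S := by
  rw [isTightMeasureSet_iff_exists_isCompact_measure_compl_le]
  intro ε hε
  obtain ⟨N, hN⟩ := ENNReal.exists_nat_gt (ENNReal.div_ne_top hM hε.ne')
  refine ⟨Metric.closedBall a (N + 1), isCompact_closedBall _ _, fun μ hμ => ?_⟩
  have hsub : (Metric.closedBall a ((N : ℝ) + 1))ᶜ ⊆ {y | ((N : ENNReal) + 1) ^ 2 ≤ q2 a y} := by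
    intro y hy
    simp only [Set.mem_compl_iff, Metric.mem_closedBall, not_le, dist_comm y a, dist_eq_norm] at hy
    simp only [Set.mem_ofPred_eq, q2_eq_ofReal]
    rw [ENNReal.ofReal_pow (norm_nonneg _)]
    gcongr
    rw [← ENNReal.ofReal_natCast, ← ENNReal.ofReal_one,
      ← ENNReal.ofReal_add (by positivity) zero_le_one]
    exact ENNReal.ofReal_le_ofReal hy.le
  have hne : ((N : ENNReal) + 1) ^ 2 ≠ 0 := by simp
  have hnt : ((N : ENNReal) + 1) ^ 2 ≠ ⊤ := by simp
  refine (measure_mono hsub).trans ((meas_ge_le_lintegral_div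
    (measurable_q2_right a).aemeasurable hne hnt).trans ?_)
  refine ENNReal.div_le_of_le_mul ((h μ hμ).trans ?_)
  rcases eq_or_ne ε ⊤ with rfl | hεt
  · simp [ENNReal.top_mul hne]
  have h1 : M ≤ N * ε := (ENNReal.div_le_iff hε.ne' hεt).1 hN.le
  rw [mul_comm ε]
  refine h1.trans (mul_le_mul_left ?_ ε)
  calc (N : ENNReal) ≤ N + 1 := le_self_add
    _ ≤ (N + 1) ^ 2 := le_self_pow₀ le_add_self two_ne_zero

/-- Completeness of `P₂` for the Wasserstein distance. -/
lemma exists_W2sq_limit {μ : ℕ → Measure E} (h0 : MemP2 (μ 0))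
    (hp : ∀ k, IsProbabilityMeasure (μ k))
    {c : ℕ → ENNReal} (hc0 : c 0 ≠ ⊤) (hc : ∀ k l, k ≤ l → W2sq (μ k) (μ l) ≤ c k) :
    ∃ π, MemP2 π ∧ ∀ k, W2sq (μ k) π ≤ c k := by
  have := hp
  obtain ⟨-, a, ha⟩ := h0
  let P : ℕ → ProbabilityMeasure E := fun k => ⟨μ k, hp k⟩
  have htight : IsTightMeasureSet
      {((m : ProbabilityMeasure E) : Measure E) | m ∈ Set.range P} := by
    refine isTightMeasureSet_of_lintegral_q2_le (a := a)
      (M := 2 * ∫⁻ x, q2 a x ∂(μ 0) + 2 * c 0) ?_ ?_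
    · exact (ENNReal.add_lt_top.2 ⟨ENNReal.mul_lt_top (by simp) ha,
        ENNReal.mul_lt_top (by simp) hc0.lt_top⟩).ne
    · rintro _ ⟨_, ⟨k, rfl⟩, rfl⟩
      refine (lintegral_q2_le (μ := μ 0) (ν := μ k) a).trans ?_
      gcongr
      exact hc 0 k k.zero_le
  obtain ⟨π, -, φ, hφ, hlim⟩ := (isCompact_closure_of_isTightMeasureSet htight).tendsto_subseq
    (fun l => subset_closure (Set.mem_range_self l))
  have hle : ∀ k, W2sq (μ k) π ≤ c k := by
    intro k
    choose γ hγ using fun l => exists_isOptCoupling (μ k) (μ (φ (l + k)))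
    obtain ⟨γ₀, hγ₀, h⟩ := exists_coupling_of_tendsto (μs := fun _ => P k) tendsto_const_nhds
      (hlim.comp (tendsto_add_atTop_nat k)) (fun l => (hγ l).1) tendsto_const_nhds
      (fun l => (hγ l).2.trans_le (hc k _ ((Nat.le_add_left k l).trans (hφ.id_le _))))
    exact (W2sq_le hγ₀).trans h
  exact ⟨π, MemP2.of_W2sq_lt_top ⟨hp 0, a, ha⟩ π.2 ((hle 0).trans_lt hc0.lt_top), hle⟩

/-- Gluing of two couplings along their common marginal. -/
lemma exists_gluing {γ' : Measure (E × E)} [IsProbabilityMeasure μ] [IsProbabilityMeasure ν]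
    (h : IsCoupling γ μ ν) (h' : IsCoupling γ' ν σ) :
    ∃ Γ : Measure ((E × E) × E), Γ.map Prod.fst = γ ∧ Γ.map (fun p => (p.1.2, p.2)) = γ' := by
  have := h.isProbabilityMeasure
  have := h'.isProbabilityMeasure
  let κ := γ'.condKernel
  refine ⟨γ.compProd (κ.comap Prod.snd measurable_snd), Measure.fst_compProd _ _, ?_⟩
  have hm : Measurable fun p : (E × E) × E => (p.1.2, p.2) := by fun_prop
  conv_rhs => rw [← γ'.disintegrate γ'.condKernel]
  ext s hs
  rw [Measure.map_apply hm hs, Measure.compProd_apply (hm hs), Measure.compProd_apply hs,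
    show γ'.fst = γ.map Prod.snd from h'.1.trans h.2.symm,
    lintegral_map (ProbabilityTheory.Kernel.measurable_kernel_prodMk_left hs) measurable_snd]
  rfl

lemma W2sq_triangle [IsProbabilityMeasure μ] [IsProbabilityMeasure ν] [IsProbabilityMeasure σ] :
    W2sq μ σ ^ (1 / 2 : ℝ) ≤ W2sq μ ν ^ (1 / 2 : ℝ) + W2sq ν σ ^ (1 / 2 : ℝ) := by
  obtain ⟨γ, hγ, hopt⟩ := exists_isOptCoupling μ ν
  obtain ⟨γ', hγ', hopt'⟩ := exists_isOptCoupling ν σ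
  obtain ⟨Γ, hΓ, hΓ'⟩ := exists_gluing hγ hγ'
  have hm : Measurable fun p : (E × E) × E => (p.1.2, p.2) := by fun_prop
  have hm' : Measurable fun p : (E × E) × E => (p.1.1, p.2) := by fun_prop
  have hc : IsCoupling (Γ.map fun p => (p.1.1, p.2)) μ σ := by
    refine ⟨?_, ?_⟩
    · rw [← hγ.1, ← hΓ, Measure.map_map measurable_fst hm',
        Measure.map_map measurable_fst measurable_fst]
      rfl
    · rw [← hγ'.2, ← hΓ', Measure.map_map measurable_snd hm', Measure.map_map measurable_snd hm]
      rfl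
  have hq : ∀ x y : E, q2 x y = ‖x - y‖ₑ ^ (2 : ℝ) := fun x y => by
    rw [q2, ← ENNReal.rpow_natCast]
    rfl
  rw [← hopt, ← hopt', ← hΓ, ← hΓ', lintegral_map measurable_q2 measurable_fst,
    lintegral_map measurable_q2 hm]
  refine (ENNReal.rpow_le_rpow (W2sq_le hc) (by norm_num)).trans ?_
  rw [lintegral_map measurable_q2 hm']
  simp only [hq]
  refine le_trans ?_ (ENNReal.lintegral_Lp_add_le (p := 2) (by fun_prop) (by fun_prop) one_le_two)
  refine ENNReal.rpow_le_rpow (lintegral_mono fun p => ?_) (by norm_num)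
  refine ENNReal.rpow_le_rpow ?_ zero_le_two
  simp only [Pi.add_apply]
  rw [← sub_add_sub_cancel p.1.1 p.1.2 p.2]
  exact enorm_add_le _ _

end Wasserstein
section MarkovStep

variable {E I : Type*} [MeasurableSpace E] [MeasurableSpace I] {T : I → E → E} {μξ : Measure I}
  [IsProbabilityMeasure μξ] {μ ν : Measure E} {γ : Measure (E × E)}

lemma markovStep_eq_map_prod (hΦ : Measurable fun p : E × I => T p.2 p.1)
    [IsProbabilityMeasure μ] :
    markovStep μξ T μ = (μ.prod μξ).map fun p => T p.2 p.1 := by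
  have hT : ∀ x, Measurable fun i => T i x := fun x => hΦ.comp measurable_prodMk_left
  have hker : Measurable fun x => μξ.map fun i => T i x := by
    refine Measure.measurable_of_measurable_coe _ fun s hs => ?_
    simp only [Measure.map_apply (hT _) hs]
    exact measurable_measure_prodMk_left (hΦ hs)
  ext s hs
  rw [markovStep, Measure.bind_apply hs hker.aemeasurable, Measure.map_apply hΦ hs,
    Measure.prod_apply (hΦ hs)]
  exact lintegral_congr fun x => Measure.map_apply (hT x) hs

lemma isProbabilityMeasure_markovStep (hΦ : Measurable fun p : E × I => T p.2 p.1)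
    [IsProbabilityMeasure μ] : IsProbabilityMeasure (markovStep μξ T μ) := by
  rw [markovStep_eq_map_prod hΦ]
  exact Measure.isProbabilityMeasure_map hΦ.aemeasurable

lemma IsCoupling.markovStep (hΦ : Measurable fun p : E × I => T p.2 p.1)
    [IsProbabilityMeasure μ] [IsProbabilityMeasure ν] (h : IsCoupling γ μ ν) :
    IsCoupling ((γ.prod μξ).map fun p => (T p.2 p.1.1, T p.2 p.1.2))
      (markovStep μξ T μ) (markovStep μξ T ν) := by
  have := h.isProbabilityMeasure
  have h1 : Measurable fun p : (E × E) × I => T p.2 p.1.1 :=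
    hΦ.comp (measurable_fst.fst.prodMk measurable_snd)
  have h2 : Measurable fun p : (E × E) × I => T p.2 p.1.2 :=
    hΦ.comp (measurable_fst.snd.prodMk measurable_snd)
  have hid : μξ.map id = μξ := Measure.map_id
  refine ⟨?_, ?_⟩
  · rw [Measure.map_map measurable_fst (h1.prodMk h2), markovStep_eq_map_prod hΦ, ← h.1, ← hid,
      Measure.map_prod_map _ _ measurable_fst measurable_id,
      Measure.map_map hΦ (measurable_fst.prodMap measurable_id), hid]
    rfl
  · rw [Measure.map_map measurable_snd (h1.prodMk h2), markovStep_eq_map_prod hΦ, ← h.2, ← hid,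
      Measure.map_prod_map _ _ measurable_snd measurable_id,
      Measure.map_map hΦ (measurable_snd.prodMap measurable_id), hid]
    rfl

end MarkovStep

section InfDist

variable {E I : Type*} [NormedAddCommGroup E] [MeasurableSpace E] [MeasurableSpace I]
  {T : I → E → E} {μξ : Measure I} {μ : Measure E}

/-- The squared Wasserstein distance to the set of invariant measures, extended-real valued. -/
def infW2sqInv (μξ : Measure I) (T : I → E → E) (μ : Measure E) : ENNReal :=
  ⨅ (π' : Measure E) (_ : π' ∈ invSet μξ T), W2sq μ π'

lemma le_mul_infW2sqInv {a κ : ENNReal} (hκ : κ ≠ ⊤) (hκ0 : κ ≠ 0)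
    (h : ∀ π' ∈ invSet μξ T, a ≤ κ * W2sq μ π') : a ≤ κ * infW2sqInv μξ T μ := by
  rw [mul_comm, ← ENNReal.div_le_iff hκ0 hκ]
  refine le_iInf₂ fun π' hπ' => ?_
  rw [ENNReal.div_le_iff hκ0 hκ, mul_comm]
  exact h π' hπ'

lemma sq_dW2inv (μ : Measure E) : dW2inv μξ T μ ^ 2 = (infW2sqInv μξ T μ).toReal :=
  Real.sq_sqrt ENNReal.toReal_nonneg

lemma sq_Psi (μ : Measure E) : Psi μξ T μ ^ 2 = (PsiSq μξ T μ).toReal :=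
  Real.sq_sqrt ENNReal.toReal_nonneg

lemma dW2inv_nonneg (μ : Measure E) : 0 ≤ dW2inv μξ T μ := Real.sqrt_nonneg _

lemma Psi_nonneg (μ : Measure E) : 0 ≤ Psi μξ T μ := Real.sqrt_nonneg _

lemma ofReal_dW2inv (h : infW2sqInv μξ T μ < ⊤) :
    ENNReal.ofReal (dW2inv μξ T μ) = infW2sqInv μξ T μ ^ (1 / 2 : ℝ) := by
  rw [dW2inv, Real.sqrt_eq_rpow, ← ENNReal.ofReal_rpow_of_nonneg ENNReal.toReal_nonneg
    (by norm_num)]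
  exact congrArg (· ^ (1 / 2 : ℝ)) (ENNReal.ofReal_toReal h.ne)

end InfDist

section Contraction

variable {E I : Type*} [NormedAddCommGroup E] [ProperSpace E] [MeasurableSpace E] [BorelSpace E]
  [MeasurableSpace I] {T : I → E → E} {μξ : Measure I} [IsProbabilityMeasure μξ]
  {μ ν : Measure E} {γ : Measure (E × E)} {τ κ : ENNReal}

lemma measurable_q2_displacement (hΦ : Measurable fun p : E × I => T p.2 p.1) :
    Measurable fun p : (E × E) × I => q2 (p.1.1 - T p.2 p.1.1) (p.1.2 - T p.2 p.1.2) := by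
  have h : Measurable fun p : E × I => p.1 - T p.2 p.1 := measurable_fst.sub hΦ
  have h1 : Measurable fun p : (E × E) × I => p.1.1 - T p.2 p.1.1 :=
    h.comp (measurable_fst.fst.prodMk measurable_snd)
  have h2 : Measurable fun p : (E × E) × I => p.1.2 - T p.2 p.1.2 :=
    h.comp (measurable_fst.snd.prodMk measurable_snd)
  exact measurable_q2.comp (h1.prodMk h2)

lemma W2sq_markovStep_add_le (hΦ : Measurable fun p : E × I => T p.2 p.1)
    (hT : ∀ x y : E, (∫⁻ i, q2 (T i x) (T i y) ∂μξ) +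
      τ * ∫⁻ i, q2 (x - T i x) (y - T i y) ∂μξ ≤ κ * q2 x y)
    [IsProbabilityMeasure μ] [IsProbabilityMeasure ν] (h : IsCoupling γ μ ν) :
    W2sq (markovStep μξ T μ) (markovStep μξ T ν) +
        τ * ∫⁻ p, (∫⁻ i, q2 (p.1 - T i p.1) (p.2 - T i p.2) ∂μξ) ∂γ ≤
      κ * ∫⁻ p, q2 p.1 p.2 ∂γ := by
  have h1 : Measurable fun p : (E × E) × I => T p.2 p.1.1 :=
    hΦ.comp (measurable_fst.fst.prodMk measurable_snd)
  have h2 : Measurable fun p : (E × E) × I => T p.2 p.1.2 :=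
    hΦ.comp (measurable_fst.snd.prodMk measurable_snd)
  have hm : Measurable fun p : (E × E) × I => q2 (T p.2 p.1.1) (T p.2 p.1.2) :=
    measurable_q2.comp (h1.prodMk h2)
  have hm' := measurable_q2_displacement hΦ
  have hW : W2sq (markovStep μξ T μ) (markovStep μξ T ν) ≤
      ∫⁻ p, (∫⁻ i, q2 (T i p.1) (T i p.2) ∂μξ) ∂γ := by
    have := h.isProbabilityMeasure
    refine (W2sq_le (h.markovStep (μξ := μξ) hΦ)).trans_eq ?_
    rw [lintegral_map measurable_q2 (h1.prodMk h2)]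
    exact lintegral_prod _ hm.aemeasurable
  refine (add_le_add_left hW _).trans ?_
  rw [← lintegral_const_mul τ (hm'.lintegral_prod_right' (ν := μξ)),
    ← lintegral_add_left (hm.lintegral_prod_right' (ν := μξ)),
    ← lintegral_const_mul κ measurable_q2]
  exact lintegral_mono fun p => hT p.1 p.2

lemma W2sq_markovStep_le (hΦ : Measurable fun p : E × I => T p.2 p.1)
    (hT : ∀ x y : E, (∫⁻ i, q2 (T i x) (T i y) ∂μξ) +
      τ * ∫⁻ i, q2 (x - T i x) (y - T i y) ∂μξ ≤ κ * q2 x y)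
    [IsProbabilityMeasure μ] [IsProbabilityMeasure ν] :
    W2sq (markovStep μξ T μ) (markovStep μξ T ν) ≤ κ * W2sq μ ν := by
  obtain ⟨γ, hγ, hopt⟩ := exists_isOptCoupling μ ν
  rw [← hopt]
  exact le_self_add.trans (W2sq_markovStep_add_le hΦ hT hγ)

lemma MemP2.markovStep (hΦ : Measurable fun p : E × I => T p.2 p.1)
    (hT : ∀ x y : E, (∫⁻ i, q2 (T i x) (T i y) ∂μξ) +
      τ * ∫⁻ i, q2 (x - T i x) (y - T i y) ∂μξ ≤ κ * q2 x y) (hκ : κ ≠ ⊤)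
    {π : Measure E} (hπ : π ∈ invSet μξ T) (hπ2 : MemP2 π) (hμ : MemP2 μ) :
    MemP2 (markovStep μξ T μ) := by
  have := hμ.1
  have := hπ.1
  refine hπ2.of_W2sq_lt_top (isProbabilityMeasure_markovStep hΦ) ?_
  have h := W2sq_markovStep_le (μ := π) (ν := μ) hΦ hT
  rw [hπ.2] at h
  exact h.trans_lt (ENNReal.mul_lt_top hκ.lt_top (hπ2.W2sq_lt_top hμ))

lemma infW2sqInv_markovStep_add_le (hΦ : Measurable fun p : E × I => T p.2 p.1)
    (hT : ∀ x y : E, (∫⁻ i, q2 (T i x) (T i y) ∂μξ) +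
      τ * ∫⁻ i, q2 (x - T i x) (y - T i y) ∂μξ ≤ κ * q2 x y) (hκ : κ ≠ ⊤) (hκ0 : κ ≠ 0)
    [IsProbabilityMeasure μ] :
    infW2sqInv μξ T (markovStep μξ T μ) + τ * PsiSq μξ T μ ≤ κ * infW2sqInv μξ T μ := by
  refine le_mul_infW2sqInv hκ hκ0 fun π' hπ' => ?_
  have := hπ'.1
  obtain ⟨γ, hγ⟩ := exists_isOptCoupling μ π'
  have h := W2sq_markovStep_add_le hΦ hT hγ.1
  rw [hπ'.2, hγ.2] at h
  refine le_trans (add_le_add (iInf₂_le π' hπ') ?_) h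
  gcongr
  exact (iInf₂_le π' hπ').trans (iInf₂_le γ hγ)

lemma PsiSq_eq_zero_of_mem_invSet {π : Measure E} (hπ : π ∈ invSet μξ T)
    (hΦ : Measurable fun p : E × I => T p.2 p.1) : PsiSq μξ T π = 0 := by
  refine le_antisymm ?_ zero_le
  refine (iInf₂_le π hπ).trans ?_
  refine (iInf₂_le (π.map fun x => (x, x)) (isOptCoupling_diag π)).trans_eq ?_
  rw [lintegral_map (measurable_q2_displacement hΦ).lintegral_prod_right' (by fun_prop)]
  simp [q2]

lemma rpow_half_mul_sq_le {a b c : ENNReal} (h : a ≤ c ^ 2 * b) :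
    a ^ (1 / 2 : ℝ) ≤ c * b ^ (1 / 2 : ℝ) := by
  refine (ENNReal.rpow_le_rpow h (by norm_num)).trans_eq ?_
  rw [ENNReal.mul_rpow_of_nonneg _ _ (by norm_num), ← ENNReal.rpow_natCast, ← ENNReal.rpow_mul]
  norm_num

/-- One step of a Markov operator that is Lipschitz on `P₂` moves a measure by at most a multiple of
its distance to the invariant measures. -/
lemma W2sq_self_markovStep_le (hΦ : Measurable fun p : E × I => T p.2 p.1)
    (hT : ∀ x y : E, (∫⁻ i, q2 (T i x) (T i y) ∂μξ) +
      τ * ∫⁻ i, q2 (x - T i x) (y - T i y) ∂μξ ≤ κ * q2 x y) (hκ : κ ≤ 2 ^ 2)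
    [IsProbabilityMeasure μ] :
    W2sq μ (markovStep μξ T μ) ^ (1 / 2 : ℝ) ≤ 3 * infW2sqInv μξ T μ ^ (1 / 2 : ℝ) := by
  have := isProbabilityMeasure_markovStep (μξ := μξ) (μ := μ) hΦ
  refine rpow_half_mul_sq_le (le_mul_infW2sqInv (by simp) (by simp) fun π' hπ' => ?_)
  have := hπ'.1
  have h1 : W2sq π' (markovStep μξ T μ) ^ (1 / 2 : ℝ) ≤ 2 * W2sq μ π' ^ (1 / 2 : ℝ) := by
    refine rpow_half_mul_sq_le ?_
    have h := W2sq_markovStep_le (μ := μ) (ν := π') hΦ hT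
    rw [hπ'.2] at h
    rw [W2sq_comm]
    exact h.trans (mul_le_mul_left hκ _)
  have h2 : W2sq μ (markovStep μξ T μ) ^ (1 / 2 : ℝ) ≤ 3 * W2sq μ π' ^ (1 / 2 : ℝ) := by
    refine (W2sq_triangle (ν := π')).trans ((add_le_add_right h1 _).trans_eq ?_)
    ring
  have h3 := ENNReal.rpow_le_rpow h2 zero_le_two
  rw [ENNReal.mul_rpow_of_nonneg _ _ zero_le_two, ← ENNReal.rpow_mul, ← ENNReal.rpow_mul] at h3
  norm_num at h3 ⊢
  exact h3

lemma W2sq_add_le_sum {μ : ℕ → Measure E} (hp : ∀ k, IsProbabilityMeasure (μ k))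
    {a : ℕ → ENNReal} (ha : ∀ k, W2sq (μ k) (μ (k + 1)) ^ (1 / 2 : ℝ) ≤ a k) (k m : ℕ) :
    W2sq (μ k) (μ (m + k)) ^ (1 / 2 : ℝ) ≤ ∑ j ∈ Finset.range m, a (j + k) := by
  have := hp
  induction m with
  | zero => simp [W2sq_self]
  | succ m ih =>
    rw [Finset.sum_range_succ, add_right_comm m 1 k]
    exact (W2sq_triangle (ν := μ (m + k))).trans (add_le_add ih (ha _))

/-- If the distances of the iterates to the invariant measures are summable, then the iterates
converge to an invariant measure. -/
lemma exists_invariant_limit (hΦ : Measurable fun p : E × I => T p.2 p.1)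
    (hT : ∀ x y : E, (∫⁻ i, q2 (T i x) (T i y) ∂μξ) +
      τ * ∫⁻ i, q2 (x - T i x) (y - T i y) ∂μξ ≤ κ * q2 x y) (hκ : κ ≤ 2 ^ 2)
    {μ₀ : Measure E} (hμ : MemP2 μ₀)
    (hsum : ∑' k, infW2sqInv μξ T ((markovStep μξ T)^[k] μ₀) ^ (1 / 2 : ℝ) ≠ ⊤) :
    ∃ π, π ∈ invSet μξ T ∧ MemP2 π ∧
      Tendsto (fun k => W2sq ((markovStep μξ T)^[k] μ₀) π) atTop (𝓝 0) := by
  set μ : ℕ → Measure E := fun k => (markovStep μξ T)^[k] μ₀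
  have hsucc : ∀ k, μ (k + 1) = markovStep μξ T (μ k) :=
    fun k => Function.iterate_succ_apply' _ _ _
  have hp : ∀ k, IsProbabilityMeasure (μ k) := by
    intro k
    induction k with
    | zero => exact hμ.1
    | succ k ih =>
      rw [hsucc]
      exact isProbabilityMeasure_markovStep hΦ
  set a : ℕ → ENNReal := fun k => 3 * infW2sqInv μξ T (μ k) ^ (1 / 2 : ℝ)
  have ha : ∀ k, W2sq (μ k) (μ (k + 1)) ^ (1 / 2 : ℝ) ≤ a k := fun k => by
    rw [hsucc]
    exact W2sq_self_markovStep_le hΦ hT hκ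
  have hasum : ∑' k, a k ≠ ⊤ := by
    rw [ENNReal.tsum_mul_left]
    exact ENNReal.mul_ne_top (by simp) hsum
  set s : ℕ → ENNReal := fun k => ∑' j, a (j + k)
  have hs : Tendsto s atTop (𝓝 0) := ENNReal.tendsto_sum_nat_add a hasum
  have hsq : ∀ {x y : ENNReal}, x ^ (1 / 2 : ℝ) ≤ y ↔ x ≤ y ^ 2 := fun {x y} => by
    rw [one_div, ENNReal.rpow_inv_le_iff two_pos, ← ENNReal.rpow_natCast]
    rfl
  obtain ⟨π, hπ2, hπ⟩ := exists_W2sq_limit (μ := μ) (c := fun k => s k ^ 2) hμ hp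
    (ENNReal.pow_ne_top hasum) (fun k l hkl => by
      obtain ⟨m, rfl⟩ := Nat.exists_eq_add_of_le' hkl
      exact hsq.1 ((W2sq_add_le_sum hp ha k m).trans (ENNReal.sum_le_tsum _)))
  have := hπ2.1
  have hstep := isProbabilityMeasure_markovStep (μξ := μξ) (μ := π) hΦ
  refine ⟨π, ⟨hπ2.1, ?_⟩, hπ2, ?_⟩
  · refine eq_of_W2sq_eq_zero ?_
    have hle : ∀ k, W2sq (markovStep μξ T π) π ^ (1 / 2 : ℝ) ≤ 2 * s k + s (k + 1) := by
      intro k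
      refine (W2sq_triangle (ν := μ (k + 1))).trans (add_le_add ?_ (hsq.2 (hπ _)))
      refine (rpow_half_mul_sq_le (c := 2) (b := W2sq (μ k) π) ?_).trans ?_
      · rw [hsucc, W2sq_comm]
        exact (W2sq_markovStep_le hΦ hT).trans (mul_le_mul_left hκ _)
      · gcongr
        exact hsq.2 (hπ k)
    have hlim : Tendsto (fun k => 2 * s k + s (k + 1)) atTop (𝓝 0) := by
      simpa using (ENNReal.Tendsto.const_mul hs (Or.inr (by simp : (2 : ENNReal) ≠ ⊤))).add
        (hs.comp (tendsto_add_atTop_nat 1))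
    have h0 := ge_of_tendsto' hlim hle
    exact (ENNReal.rpow_eq_zero_iff_of_pos (by norm_num)).1 (le_antisymm h0 zero_le)
  · refine tendsto_of_tendsto_of_tendsto_of_le_of_le tendsto_const_nhds ?_ (fun _ => zero_le) hπ
    simpa using ENNReal.Tendsto.pow (n := 2) hs

end Contraction

section Rate

variable {E I : Type*} [NormedAddCommGroup E] [ProperSpace E] [MeasurableSpace E] [BorelSpace E]
  [MeasurableSpace I] {T : I → E → E} {μξ : Measure I} {μ : Measure E}

lemma MemP2.infW2sqInv_lt_top {π : Measure E} (hπ : π ∈ invSet μξ T) (hπ2 : MemP2 π)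
    (hμ : MemP2 μ) : infW2sqInv μξ T μ < ⊤ :=
  (iInf₂_le π hπ).trans_lt (hμ.W2sq_lt_top hπ2)

lemma sq_dW2inv_markovStep_add_le [IsProbabilityMeasure μξ]
    (hΦ : Measurable fun p : E × I => T p.2 p.1) {t c : ℝ} (ht : 0 < t) (hc : 0 < c)
    (hT : ∀ x y : E, (∫⁻ i, q2 (T i x) (T i y) ∂μξ) +
      ENNReal.ofReal t * ∫⁻ i, q2 (x - T i x) (y - T i y) ∂μξ ≤ ENNReal.ofReal c * q2 x y)
    {π : Measure E} (hπ : π ∈ invSet μξ T) (hπ2 : MemP2 π) (hμ : MemP2 μ) :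
    dW2inv μξ T (markovStep μξ T μ) ^ 2 + t * Psi μξ T μ ^ 2 ≤ c * dW2inv μξ T μ ^ 2 := by
  have := hμ.1
  have h := infW2sqInv_markovStep_add_le (μ := μ) hΦ hT ENNReal.ofReal_ne_top
    (ENNReal.ofReal_pos.2 hc).ne'
  have hfin : ENNReal.ofReal c * infW2sqInv μξ T μ ≠ ⊤ :=
    ENNReal.mul_ne_top ENNReal.ofReal_ne_top (MemP2.infW2sqInv_lt_top hπ hπ2 hμ).ne
  have hsum := ENNReal.add_ne_top.1 (ne_top_of_le_ne_top hfin h)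
  have h' := ENNReal.toReal_mono hfin h
  rw [ENNReal.toReal_add hsum.1 hsum.2, ENNReal.toReal_mul, ENNReal.toReal_mul,
    ENNReal.toReal_ofReal ht.le, ENNReal.toReal_ofReal hc.le] at h'
  rwa [sq_dW2inv, sq_dW2inv, sq_Psi]

lemma dW2inv_le_of_PsiSq [IsProbabilityMeasure μξ] (hΦ : Measurable fun p : E × I => T p.2 p.1)
    (hzero : ∀ μ, MemP2 μ → PsiSq μξ T μ = 0 → μ ∈ invSet μξ T)
    {π : Measure E} (hπ : π ∈ invSet μξ T) (hπ2 : MemP2 π) (hμ : MemP2 μ) :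
    dW2inv μξ T μ ≤ Real.sqrt ((⨅ (π' : Measure E)
      (_ : MemP2 π' ∧ PsiSq μξ T π' = 0), W2sq μ π').toReal) := by
  refine Real.sqrt_le_sqrt (ENNReal.toReal_mono ?_ ?_)
  · exact ((iInf₂_le π ⟨hπ2, PsiSq_eq_zero_of_mem_invSet hπ hΦ⟩).trans_lt
      (hμ.W2sq_lt_top hπ2)).ne
  · exact le_iInf₂ fun π' h => iInf₂_le π' (hzero π' h.1 h.2)

end Rate

/-- convergence rates: `T i : ℝⁿ → ℝⁿ` continuous; (a) there is an
invariant probability measure with finite second moment; (b) the update function is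
almost α-firmly nonexpansive in expectation with constant `α ∈ (0,1)` and violation
`ε ∈ [0,1)`; (c) the Markov transport discrepancy `Ψ` vanishes only at invariant
measures and is metrically subregular for `0` on `P₂(ℝⁿ)` with gauge `ρ` related to
`τ = (1-α)/α` via `θ(ρ(t))² = (1+ε)ρ(t)² − τ·t²`, where `θ` satisfies `θ(0)=0`,
`0 < θ(t) < t` for `t > 0` and `∑_{j≥1} θ^{(j)}(t) < ∞`.  Then for every
`μ₀ ∈ P₂(ℝⁿ)` the iterates `μ_k = μ₀𝒫ᵏ` converge in `W₂` to some invariant measure in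
`P₂(ℝⁿ)`, with rate `d_{W₂}(μ_{k+1}, inv 𝒫) ≤ θ(d_{W₂}(μ_k, inv 𝒫))`. -/
theorem stmt15
    {n : ℕ} {I : Type*} [MeasurableSpace I]
    (T : I → EuclideanSpace ℝ (Fin n) → EuclideanSpace ℝ (Fin n))
    (hT : ∀ i, Continuous (T i))
    (hΦ : Measurable fun p : EuclideanSpace ℝ (Fin n) × I => T p.2 p.1)
    (μξ : Measure I) [IsProbabilityMeasure μξ]
    (α ε : ℝ) (hα0 : 0 < α) (hα1 : α < 1) (hε0 : 0 ≤ ε) (hε1 : ε < 1)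
    -- (a) existence of an invariant measure in P₂
    (hinv : ∃ π, π ∈ invSet μξ T ∧ MemP2 π)
    -- (b) Φ is almost α-firmly nonexpansive in expectation with violation ε
    (haafne : ∀ x y : EuclideanSpace ℝ (Fin n),
      (∫⁻ i, q2 (T i x) (T i y) ∂μξ) +
        ENNReal.ofReal ((1 - α) / α) * ∫⁻ i, q2 (x - T i x) (y - T i y) ∂μξ ≤
      ENNReal.ofReal (1 + ε) * q2 x y)
    -- the gauge ρ and the associated function θ
    (ρ θ : ℝ → ℝ)
    (hρ0 : ρ 0 = 0) (hρmono : StrictMonoOn ρ (Set.Ici (0 : ℝ)))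
    (hρcont : ContinuousOn ρ (Set.Ici (0 : ℝ)))
    (hρtop : Tendsto ρ atTop atTop)
    (hρnonneg : ∀ t : ℝ, 0 ≤ t → 0 ≤ ρ t)
    (hρθ : ∀ t : ℝ, 0 ≤ t →
      (θ (ρ t)) ^ 2 = (1 + ε) * (ρ t) ^ 2 - ((1 - α) / α) * t ^ 2)
    (hθ0 : θ 0 = 0) (hθlt : ∀ t : ℝ, 0 < t → 0 < θ t ∧ θ t < t)
    (hθsum : ∀ t : ℝ, 0 ≤ t → Summable fun j : ℕ => θ^[j + 1] t)
    -- (c) Ψ vanishes only at invariant measures and is metrically subregular for 0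
    (hzero : ∀ μ, MemP2 μ → PsiSq μξ T μ = 0 → μ ∈ invSet μξ T)
    (hsubreg : ∀ μ, MemP2 μ →
      Real.sqrt ((⨅ (π' : Measure (EuclideanSpace ℝ (Fin n)))
          (_ : MemP2 π' ∧ PsiSq μξ T π' = 0), W2sq μ π').toReal) ≤ ρ (Psi μξ T μ)) :
    ∀ μ₀, MemP2 μ₀ →
      (∃ π, π ∈ invSet μξ T ∧ MemP2 π ∧
        Tendsto (fun k => W2r ((markovStep μξ T)^[k] μ₀) π) atTop (nhds 0)) ∧
      ∀ k : ℕ, dW2inv μξ T ((markovStep μξ T)^[k + 1] μ₀) ≤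
        θ (dW2inv μξ T ((markovStep μξ T)^[k] μ₀)) := by
  obtain ⟨π, hπ, hπ2⟩ := hinv
  have hτ : 0 < (1 - α) / α := div_pos (by linarith) hα0
  have hθnn : ∀ t, 0 ≤ t → 0 ≤ θ t := fun t ht => by
    simpa using iterate_nonneg_of_lt_self hθ0 hθlt ht 1
  have hrate : ∀ μ, MemP2 μ → dW2inv μξ T (markovStep μξ T μ) ≤ θ (dW2inv μξ T μ) := by
    intro μ hμ
    have h := sq_dW2inv_markovStep_add_le hΦ hτ (by linarith) haafne hπ hπ2 hμ
    have hd : dW2inv μξ T μ ≤ ρ (Psi μξ T μ) :=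
      (dW2inv_le_of_PsiSq hΦ hzero hπ hπ2 hμ).trans (hsubreg μ hμ)
    have hmem : dW2inv μξ T μ ∈ ρ '' Set.Ici 0 := by
      rw [image_Ici_of_gauge hρ0 hρcont hρtop hρnonneg]
      exact dW2inv_nonneg μ
    obtain ⟨t, ht, htd⟩ := hmem
    have htψ : t ≤ Psi μξ T μ := by
      rw [← htd] at hd
      exact (hρmono.le_iff_le ht (Set.mem_Ici.2 (Psi_nonneg μ))).1 hd
    have hsq := hρθ t ht
    rw [htd] at hsq
    refine (sq_le_sq₀ (dW2inv_nonneg _) (hθnn _ (dW2inv_nonneg μ))).1 ?_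
    rw [hsq]
    have := mul_le_mul_of_nonneg_left (pow_le_pow_left₀ ht htψ 2) hτ.le
    linarith
  intro μ₀ hμ₀
  have hP2 : ∀ k, MemP2 ((markovStep μξ T)^[k] μ₀) := by
    intro k
    induction k with
    | zero => exact hμ₀
    | succ k ih =>
      rw [Function.iterate_succ_apply']
      exact MemP2.markovStep hΦ haafne ENNReal.ofReal_ne_top hπ hπ2 ih
  have hk : ∀ k : ℕ, dW2inv μξ T ((markovStep μξ T)^[k + 1] μ₀) ≤
      θ (dW2inv μξ T ((markovStep μξ T)^[k] μ₀)) := fun k => by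
    rw [Function.iterate_succ_apply']
    exact hrate _ (hP2 k)
  refine ⟨?_, hk⟩
  have hθcont := continuousOn_of_gauge hρ0 hρmono hρcont hρtop hρnonneg hρθ hθnn
  have hsum : Summable fun k => dW2inv μξ T ((markovStep μξ T)^[k] μ₀) :=
    summable_of_succ_le hθcont hθ0 hθlt hθsum (fun k => dW2inv_nonneg _) hk
  have hκ : ENNReal.ofReal (1 + ε) ≤ 2 ^ 2 := by
    rw [ENNReal.ofReal_le_iff_le_toReal (by simp)]
    norm_num
    linarith
  obtain ⟨π', h1, h2, h3⟩ := exists_invariant_limit hΦ haafne hκ hμ₀ (by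
    simp_rw [← ofReal_dW2inv (MemP2.infW2sqInv_lt_top hπ hπ2 (hP2 _))]
    exact hsum.tsum_ofReal_ne_top)
  refine ⟨π', h1, h2, ?_⟩
  have h4 := (Real.continuous_sqrt.tendsto _).comp
    ((ENNReal.tendsto_toReal ENNReal.zero_ne_top).comp h3)
  simpa [W2r, Function.comp_def] using h4
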